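/- Let d ≥ 1, let M ⊆ ℝ^{2d} be open, and let H, K : M → ℝ be smooth functions whose Poisson bracket vanishes identically, i.e. ω₀(X_H(x), X_K(x)) = 0 for every x ∈ M. Set Ĥ := (1/2)(H + K), and let γ : ℝ → M be a nonconstant T-periodic orbit of X_Ĥ (T > 0). If there exists t₀ with X_H(γ(t₀)) and X_K(γ(t₀)) linearly independent, then γ is not isolated: there exist ε > 0 and a smooth map Γ : (−ε,ε) × ℝ → M such that, writing γ_s := Γ(s,·), each γ_s is a T-periodic orbit of X_Ĥ, γ_0 = γ, Ĥ(γ_s(t)) = Ĥ(γ(t)) for all s and t (same energy), and for every s ≠ 0 the image γ_s(ℝ) is different from γ(ℝ) (the orbits are geometrically distinct). (This is Lemma 4.3 of the paper, stated for open subsets of the standard symplectic ℝ^{2d}.) -/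

import Mathlib

noncomputable section

open Set

/-- Phase space `ℝ^{2d}`, written as pairs `(p, q)` with `p q : Fin d → ℝ`. -/
abbrev Phase (d : ℕ) := (Fin d → ℝ) × (Fin d → ℝ)

/-- The standard symplectic form `ω₀` on `ℝ^{2d}`:
`ω₀(u,v) = ∑ i, (u_i v_{d+i} - u_{d+i} v_i)`. -/
def omega0 {d : ℕ} (u v : Phase d) : ℝ :=
  ∑ i, (u.1 i * v.2 i - u.2 i * v.1 i)

/-- The Hamiltonian vector field `X_H` of `H`, characterized by
`ω₀(X_H(x), v) = DH(x) v` for all `v`. -/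
def hamVF {d : ℕ} (H : Phase d → ℝ) (x : Phase d) : Phase d :=
  (fun i => fderiv ℝ H x (0, Pi.single i 1),
   fun i => - fderiv ℝ H x (Pi.single i 1, 0))

/-- `γ` is a `T`-periodic orbit of `X_H`. -/
def IsPeriodicOrbit {d : ℕ} (H : Phase d → ℝ) (γ : ℝ → Phase d) (T : ℝ) : Prop :=
  (∀ t, HasDerivAt γ (hamVF H (γ t)) t) ∧ (∀ t, γ (t + T) = γ t)

/-- `H` is pre-admissible supported in `U`, with maximum value `m`:
`0 ≤ H ≤ m`, `H ≡ 0` on some nonempty open subset of `U`, and `H ≡ m`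
outside some compact subset of `U`. -/
def PreAdmissible {d : ℕ} (H : Phase d → ℝ) (U : Set (Phase d)) (m : ℝ) : Prop :=
  ContDiff ℝ (⊤ : ℕ∞) H ∧ (∀ x, 0 ≤ H x ∧ H x ≤ m) ∧
  (∃ V : Set (Phase d), IsOpen V ∧ V.Nonempty ∧ V ⊆ U ∧ ∀ x ∈ V, H x = 0) ∧
  (∃ K : Set (Phase d), IsCompact K ∧ K ⊆ U ∧ ∀ x ∉ K, H x = m)

/-- A free Hamiltonian circle action of period 1 on the open set `N`,
generated by `H₁`. -/
def FreeHamCircleAction {d : ℕ} (N : Set (Phase d)) (H₁ : Phase d → ℝ)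
    (φ : ℝ → Phase d → Phase d) : Prop :=
  ContDiffOn ℝ (⊤ : ℕ∞) (fun p : ℝ × Phase d => φ p.1 p.2) (Set.univ ×ˢ N) ∧
  (∀ t, ∀ x ∈ N, φ t x ∈ N) ∧
  (∀ x ∈ N, φ 0 x = x) ∧
  (∀ s t, ∀ x ∈ N, φ s (φ t x) = φ (s + t) x) ∧
  (∀ t, ∀ x ∈ N, φ (t + 1) x = φ t x) ∧
  (∀ t, ∀ x ∈ N, HasDerivAt (fun s => φ s x) (hamVF H₁ (φ t x)) t) ∧
  (∀ t, ∀ x ∈ N, φ t x = x → ∃ j : ℤ, t = (j : ℝ))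

open Set Filter Topology Asymptotics NNReal

section abstract_part
variable {E : Type*} [NormedAddCommGroup E] [NormedSpace ℝ E]

lemma quad_bound {f : E → E} {C : ℝ≥0} (hf : Differentiable ℝ f)
    (hC : LipschitzWith C (fderiv ℝ f)) (y w : E) :
    ‖f (y + w) - f y - fderiv ℝ f y w‖ ≤ C * ‖w‖ * ‖w‖ := by
  have := Convex.norm_image_sub_le_of_norm_hasFDerivWithin_le' (f := f) (f' := fderiv ℝ f)
    (φ := fderiv ℝ f y) (s := Metric.closedBall y ‖w‖) (C := C * ‖w‖) (x := y) (y := y + w)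
    (fun x _ => (hf x).hasFDerivAt.hasFDerivWithinAt)
    (fun x hx => by
      have h1 := hC.dist_le_mul x y
      rw [dist_eq_norm] at h1
      exact h1.trans (mul_le_mul_of_nonneg_left (by simpa using hx) C.2))
    (convex_closedBall _ _) (by simp) (by simp)
  simpa using this

lemma transport {X Z : E → E} {K C : ℝ≥0} {B : ℝ} (hXd : Differentiable ℝ X)
    (hXl : LipschitzWith K X) (hX2 : LipschitzWith C (fderiv ℝ X))
    (hZd : Differentiable ℝ Z) (hZB : ∀ x, ‖Z x‖ ≤ B)
    {u : ℝ → ℝ → E} {a t : ℝ} (ha : 0 ≤ a)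
    (hu : ∀ s ∈ Icc 0 a, ∀ t, HasDerivAt (fun s => u s t) (X (u s t)) s)
    (hu0 : HasDerivAt (u 0) (Z (u 0 t)) t)
    (hcomm : ∀ s ∈ Icc 0 a, fderiv ℝ Z (u s t) (X (u s t)) = fderiv ℝ X (u s t) (Z (u s t))) :
    HasDerivAt (u a) (Z (u a t)) t := by
  have hB : 0 ≤ B := (norm_nonneg _).trans (hZB 0)
  rw [hasDerivAt_iff_isLittleO_nhds_zero] at hu0 ⊢
  have key : ∀ h : ℝ, ‖u a (t + h) - u a t - h • Z (u a t)‖ ≤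
      Real.exp ((K + 1 : ℝ≥0) * a) * ‖u 0 (t + h) - u 0 t - h • Z (u 0 t)‖ +
      (C * B * B / (K + 1 : ℝ≥0) * (Real.exp ((K + 1 : ℝ≥0) * a) - 1)) * h ^ 2 := by
    intro h
    have hv : ∀ s ∈ Icc 0 a, HasDerivAt (fun s => u s t + h • Z (u s t))
        (X (u s t) + h • fderiv ℝ Z (u s t) (X (u s t))) s := fun s hs =>
      (hu s hs t).add (((hZd _).hasFDerivAt.comp_hasDerivAt s (hu s hs t)).const_smul h)
    have := dist_le_of_approx_trajectories_ODE (v := fun _ => X) (K := K + 1) (a := 0) (b := a)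
      (f := fun s => u s (t + h)) (f' := fun s => X (u s (t + h)))
      (g := fun s => u s t + h • Z (u s t))
      (g' := fun s => X (u s t) + h • fderiv ℝ Z (u s t) (X (u s t)))
      (εf := 0) (εg := C * B * B * h ^ 2) (δ := ‖u 0 (t + h) - u 0 t - h • Z (u 0 t)‖)
      (fun _ => hXl.weaken (by simp))
      (fun s hs => (hu s hs _).continuousAt.continuousWithinAt)
      (fun s hs => (hu s (Ico_subset_Icc_self hs) _).hasDerivWithinAt)
      (fun s hs => by simp)
      (fun s hs => (hv s hs).continuousAt.continuousWithinAt)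
      (fun s hs => (hv s (Ico_subset_Icc_self hs)).hasDerivWithinAt)
      (fun s hs => by
        rw [hcomm s (Ico_subset_Icc_self hs), dist_comm, dist_eq_norm]
        have h1 := quad_bound hXd hX2 (u s t) (h • Z (u s t))
        rw [map_smul, sub_sub] at h1
        refine h1.trans ?_
        have h2 : ‖h • Z (u s t)‖ ≤ |h| * B := by
          rw [norm_smul]
          exact mul_le_mul_of_nonneg_left (hZB _) (abs_nonneg _)
        calc (C : ℝ) * ‖h • Z (u s t)‖ * ‖h • Z (u s t)‖ ≤ C * (|h| * B) * (|h| * B) := by gcongr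
          _ = C * B * B * h ^ 2 := by rw [← sq_abs h]; ring)
      (by rw [dist_eq_norm, sub_sub])
      a (right_mem_Icc.2 ha)
    rw [dist_eq_norm, ← sub_sub, gronwallBound_of_K_ne_0 (by positivity)] at this
    refine this.trans (le_of_eq ?_)
    simp only [sub_zero, zero_add]
    ring
  refine IsBigO.trans_isLittleO (IsBigO.of_bound' (Eventually.of_forall fun h => ?_))
    ((hu0.norm_left.const_mul_left (Real.exp ((K + 1 : ℝ≥0) * a))).add
    (IsLittleO.const_mul_left (isLittleO_pow_id (𝕜 := ℝ) (n := 2) (by norm_num))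
      (C * B * B / (K + 1 : ℝ≥0) * (Real.exp ((K + 1 : ℝ≥0) * a) - 1))))
  exact (key h).trans (le_abs_self _)

/-- existence of the flow for a bounded Lipschitz field -/
lemma exists_flow [CompleteSpace E] {X : E → E} {K : ℝ≥0} {L : ℝ≥0}
    (hXl : LipschitzWith K X) (hXB : ∀ x, ‖X x‖ ≤ L) :
    ∃ Ψ : ℝ → E → E, (∀ x, Ψ 0 x = x) ∧
      ∀ s ∈ Ioo (-1 : ℝ) 1, ∀ x, HasDerivAt (fun s => Ψ s x) (X (Ψ s x)) s := by
  have : ∀ x : E, ∃ α : ℝ → E, α 0 = x ∧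
      ∀ t ∈ Icc (-1 : ℝ) 1, HasDerivWithinAt α (X (α t)) (Icc (-1) 1) t := fun x =>
    (IsPicardLindelof.of_time_independent (f := X) (tmin := -1) (tmax := 1)
      (t₀ := ⟨0, by norm_num⟩) (x₀ := x) (a := L) (r := 0) (L := L) (K := K)
      (fun x _ => hXB x) hXl.lipschitzOnWith (by simp)).exists_eq_forall_mem_Icc_hasDerivWithinAt₀
  choose α h0 h1 using this
  exact ⟨fun s x => α x s, h0, fun s hs x =>
    (h1 x s (Ioo_subset_Icc_self hs)).hasDerivAt (Icc_mem_nhds hs.1 hs.2)⟩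

lemma smooth_of_partials {X Z : E → E} (hX : ContDiff ℝ (⊤ : ℕ∞) X) (hZ : ContDiff ℝ (⊤ : ℕ∞) Z)
    {L : ℝ≥0} (hXB : ∀ x, ‖X x‖ ≤ L)
    {Γ : ℝ → ℝ → E} {ε : ℝ}
    (h1 : ∀ s ∈ Ioo (-ε) ε, ∀ t, HasDerivAt (fun s => Γ s t) (X (Γ s t)) s)
    (h2 : ∀ s ∈ Ioo (-ε) ε, ∀ t, HasDerivAt (Γ s) (Z (Γ s t)) t) :
    ContDiffOn ℝ (⊤ : ℕ∞) (fun p : ℝ × ℝ => Γ p.1 p.2) (Ioo (-ε) ε ×ˢ univ) := by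
  have hU : IsOpen (Ioo (-ε) ε ×ˢ (univ : Set ℝ)) := isOpen_Ioo.prod isOpen_univ
  have hc : ContinuousOn (fun p : ℝ × ℝ => Γ p.1 p.2) (Ioo (-ε) ε ×ˢ univ) := by
    refine continuousOn_prod_of_continuousOn_lipschitzOnWith _ L
      (fun s hs t _ => (h2 s hs t).continuousAt.continuousWithinAt) (fun t _ => ?_)
    exact (convex_Ioo _ _).lipschitzOnWith_of_nnnorm_hasDerivWithin_le
      (fun s hs => (h1 s hs t).hasDerivWithinAt) (fun s hs => hXB _)
  let A : E → (ℝ × ℝ →L[ℝ] E) := fun x =>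
    (ContinuousLinearMap.toSpanSingleton ℝ (X x)).coprod (ContinuousLinearMap.toSpanSingleton ℝ (Z x))
  have hA : ContDiff ℝ (⊤ : ℕ∞) A := by
    have : A = fun x => (ContinuousLinearMap.fst ℝ ℝ ℝ).smulRight (X x) +
        (ContinuousLinearMap.snd ℝ ℝ ℝ).smulRight (Z x) := by
      ext x <;> simp [A]
    rw [this]
    fun_prop
  have hd : ∀ p ∈ Ioo (-ε) ε ×ˢ (univ : Set ℝ),
      HasFDerivAt (fun p : ℝ × ℝ => Γ p.1 p.2) (A (Γ p.1 p.2)) p := by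
    intro p hp
    have hcp := hc.continuousAt (hU.mem_nhds hp)
    refine (hasStrictFDerivAt_uncurry_coprod (f := Γ)
      (f₁ := fun s t => ContinuousLinearMap.toSpanSingleton ℝ (X (Γ s t)))
      (f₂ := fun s t => ContinuousLinearMap.toSpanSingleton ℝ (Z (Γ s t)))
      ?_ ?_ ?_ ?_).hasFDerivAt
    · filter_upwards [hU.mem_nhds hp] with q hq
      exact (h1 q.1 hq.1 q.2).hasFDerivAt
    · filter_upwards [hU.mem_nhds hp] with q hq
      exact (h2 q.1 hq.1 q.2).hasFDerivAt
    · have := (ContinuousLinearMap.toSpanSingletonCLE (𝕜 := ℝ) (E := E)).continuous.continuousAt.comp (hX.continuous.continuousAt.comp hcp)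
      exact this
    · have := (ContinuousLinearMap.toSpanSingletonCLE (𝕜 := ℝ) (E := E)).continuous.continuousAt.comp (hZ.continuous.continuousAt.comp hcp)
      exact this
  refine contDiffOn_infty.2 fun n => ?_
  induction n with
  | zero => exact contDiffOn_zero.2 hc
  | succ n ih =>
    push_cast
    rw [contDiffOn_succ_iff_fderiv_of_isOpen hU]
    refine ⟨fun p hp => (hd p hp).differentiableAt.differentiableWithinAt, by simp, ?_⟩
    refine ContDiffOn.congr ?_ (fun p hp => (hd p hp).fderiv)
    exact (hA.of_le (by exact_mod_cast le_top)).comp_contDiffOn ih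


lemma exists_family [CompleteSpace E] {X Z : E → E}
    (hX : ContDiff ℝ (⊤ : ℕ∞) X) (hZ : ContDiff ℝ (⊤ : ℕ∞) Z)
    (hXc : HasCompactSupport X) (hZc : HasCompactSupport Z)
    {N : Set E} (hN : IsOpen N)
    (hcomm : ∀ x ∈ N, fderiv ℝ Z x (X x) = fderiv ℝ X x (Z x))
    {γ : ℝ → E} (hγ : ∀ t, HasDerivAt γ (Z (γ t)) t) (hS : IsCompact (range γ))
    (hSN : range γ ⊆ N) :
    ∃ ε > (0 : ℝ), ∃ Ψ : ℝ → E → E, (∀ x, Ψ 0 x = x) ∧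
      ContDiffOn ℝ (⊤ : ℕ∞) (fun p : ℝ × ℝ => Ψ p.1 (γ p.2)) (Ioo (-ε) ε ×ˢ univ) ∧
      ∀ s ∈ Ioo (-ε) ε, ∀ t, Ψ s (γ t) ∈ N ∧
        HasDerivAt (fun s => Ψ s (γ t)) (X (Ψ s (γ t))) s ∧
        HasDerivAt (fun t => Ψ s (γ t)) (Z (Ψ s (γ t))) t := by
  obtain ⟨K, hK⟩ := hX.lipschitzWith_of_hasCompactSupport hXc (by simp)
  obtain ⟨C, hC⟩ := ContDiff.lipschitzWith_of_hasCompactSupport (hXc.fderiv ℝ)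
    (hX.fderiv_right (m := (⊤ : ℕ∞)) (by simp)) (by simp)
  obtain ⟨L₀, hL₀⟩ := hXc.exists_bound_of_continuous hX.continuous
  obtain ⟨B, hB⟩ := hZc.exists_bound_of_continuous hZ.continuous
  obtain ⟨L, hL⟩ : ∃ L : ℝ≥0, ∀ x, ‖X x‖ ≤ L :=
    ⟨L₀.toNNReal, fun x => (hL₀ x).trans (Real.le_coe_toNNReal _)⟩
  obtain ⟨Ψ, hΨ0, hΨ⟩ := exists_flow hK hL
  obtain ⟨δ, hδ, hδN⟩ := hS.exists_thickening_subset_open hN hSN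
  have hε : 0 < min 1 (δ / (L + 1)) := by positivity
  have h1 : ∀ s ∈ Ioo (-min 1 (δ / (L + 1))) (min 1 (δ / (L + 1))), ∀ x,
      HasDerivAt (fun s => Ψ s x) (X (Ψ s x)) s := fun s hs x =>
    hΨ s ⟨(neg_le_neg (min_le_left _ _)).trans_lt hs.1, hs.2.trans_le (min_le_left _ _)⟩ x
  have hmem : ∀ s ∈ Ioo (-min 1 (δ / (L + 1))) (min 1 (δ / (L + 1))), ∀ t, Ψ s (γ t) ∈ N := by
    intro s hs t
    apply hδN
    rw [Metric.mem_thickening_iff]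
    refine ⟨γ t, mem_range_self t, ?_⟩
    have := (convex_Ioo (-min 1 (δ / (L + 1))) (min 1 (δ / (L + 1)))).norm_image_sub_le_of_norm_hasDerivWithin_le
      (fun s hs => (h1 s hs (γ t)).hasDerivWithinAt) (fun s _ => hL _)
      (x := 0) (y := s) ⟨by simpa using hε, hε⟩ hs
    rw [hΨ0] at this
    rw [dist_eq_norm]
    refine this.trans_lt ?_
    have h3 : |s| < δ / (L + 1) := (abs_lt.2 hs).trans_le (min_le_right _ _)
    rw [lt_div_iff₀ (by positivity)] at h3
    rw [sub_zero, Real.norm_eq_abs]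
    nlinarith [abs_nonneg s]
  have h2 : ∀ s ∈ Ioo (-min 1 (δ / (L + 1))) (min 1 (δ / (L + 1))), ∀ t,
      HasDerivAt (fun t => Ψ s (γ t)) (Z (Ψ s (γ t))) t := by
    intro s hs t
    have h00 : (fun t => Ψ 0 (γ t)) = γ := funext fun t => hΨ0 _
    rcases le_total 0 s with h0 | h0
    · refine transport (u := fun s t => Ψ s (γ t)) (hX.differentiable (by simp)) hK hC
        (hZ.differentiable (by simp)) hB h0 (fun r hr t => h1 r ⟨?_, ?_⟩ _) ?_
        (fun r hr => hcomm _ (hmem r ⟨?_, ?_⟩ t))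
      · linarith [hr.1]
      · linarith [hr.2, hs.2]
      · simp only [hΨ0]
        exact hγ t
      · linarith [hr.1]
      · linarith [hr.2, hs.2]
    · have hneg : fderiv ℝ (fun x => - X x) = fun x => - fderiv ℝ X x := by
        ext x : 1
        exact fderiv_fun_neg
      have := transport (X := fun x => - X x) (u := fun s t => Ψ (-s) (γ t)) (a := -s) (t := t)
        (hX.differentiable (by simp)).fun_neg (K := K) (C := C)
        (LipschitzWith.of_dist_le_mul fun x y => by simpa using hK.dist_le_mul x y)
        (by
          rw [hneg]
          exact LipschitzWith.of_dist_le_mul fun x y => by simpa using hC.dist_le_mul x y)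
        (hZ.differentiable (by simp)) hB (by linarith)
        (fun r hr t => by
          have := (h1 (-r) ⟨by linarith [hr.2, hs.1], by linarith [hr.1]⟩ (γ t)).scomp r
            (hasDerivAt_neg r)
          simpa using! this)
        (by
          simp only [neg_zero, hΨ0]
          exact hγ t)
        (fun r hr => by
          have := hcomm _ (hmem (-r) ⟨by linarith [hr.2, hs.1], by linarith [hr.1]⟩ t)
          simp [this])
      simpa using this
  exact ⟨_, hε, Ψ, hΨ0, smooth_of_partials hX hZ hL (fun s hs t => h1 s hs (γ t)) h2,
    fun s hs t => ⟨hmem s hs t, h1 s hs _, h2 s hs t⟩⟩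

lemma cutoff {χ f : E → ℝ} {M Kc : Set E} (hM : IsOpen M) (hKc : IsCompact Kc) (hKM : Kc ⊆ M)
    (hχ : ContDiff ℝ (⊤ : ℕ∞) χ) (h0 : ∀ x ∉ Kc, χ x = 0) (hf : ContDiffOn ℝ (⊤ : ℕ∞) f M) :
    ContDiff ℝ (⊤ : ℕ∞) (fun x => χ x * f x) ∧ HasCompactSupport (fun x => χ x * f x) := by
  constructor
  · rw [contDiff_iff_contDiffAt]
    intro x
    by_cases hx : x ∈ M
    · exact hχ.contDiffAt.mul (hf.contDiffAt (hM.mem_nhds hx))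
    · have : (fun x => χ x * f x) =ᶠ[𝓝 x] fun _ => 0 := by
        filter_upwards [hKc.isClosed.isOpen_compl.mem_nhds (fun h => hx (hKM h))] with y hy
        simp [h0 y hy]
      exact contDiffAt_const.congr_of_eventuallyEq this
  · exact HasCompactSupport.intro hKc fun x hx => by simp [h0 x hx]

end abstract_part

section ham_part
variable {d : ℕ}

/-- The inverse of `v ↦ ω₀(v, ·)`. -/
def symJ (d : ℕ) : (Phase d →L[ℝ] ℝ) →L[ℝ] Phase d :=
  ContinuousLinearMap.prod
    (ContinuousLinearMap.pi fun i => ContinuousLinearMap.apply ℝ ℝ ((0, Pi.single i 1) : Phase d))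
    (ContinuousLinearMap.pi fun i => - ContinuousLinearMap.apply ℝ ℝ ((Pi.single i 1, 0) : Phase d))

lemma hamVF_eq (H : Phase d → ℝ) (x : Phase d) : hamVF H x = symJ d (fderiv ℝ H x) := rfl

lemma omega0_symJ (φ : Phase d →L[ℝ] ℝ) (v : Phase d) : omega0 (symJ d φ) v = φ v := by
  have hv : v = ∑ i, (v.1 i • ((Pi.single i 1, 0) : Phase d) + v.2 i • ((0, Pi.single i 1) : Phase d)) := by
    ext j
    · simp [Prod.fst_sum, Finset.sum_apply, Pi.single_apply]
    · simp [Prod.snd_sum, Finset.sum_apply, Pi.single_apply]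
  conv_rhs => rw [hv]
  rw [map_sum]
  unfold omega0
  refine Finset.sum_congr rfl fun i _ => ?_
  rw [map_add, map_smul, map_smul]
  simp only [symJ, ContinuousLinearMap.prod_apply, ContinuousLinearMap.coe_pi',
    ContinuousLinearMap.apply_apply, ContinuousLinearMap.neg_apply, smul_eq_mul]
  ring

lemma omega0_antisymm (u v : Phase d) : omega0 u v = - omega0 v u := by
  unfold omega0
  rw [← Finset.sum_neg_distrib]
  exact Finset.sum_congr rfl fun i _ => by ring

lemma symJ_skew (φ ψ : Phase d →L[ℝ] ℝ) : φ (symJ d ψ) = - ψ (symJ d φ) := by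
  rw [← omega0_symJ, ← omega0_symJ, omega0_antisymm]

lemma contDiff_hamVF {H : Phase d → ℝ} (hH : ContDiff ℝ (⊤ : ℕ∞) H) :
    ContDiff ℝ (⊤ : ℕ∞) (hamVF H) :=
  (symJ d).contDiff.comp (hH.fderiv_right (m := (⊤ : ℕ∞)) (by simp))

lemma hasCompactSupport_hamVF {H : Phase d → ℝ} (hH : HasCompactSupport H) :
    HasCompactSupport (hamVF H) :=
  (hH.fderiv ℝ).comp_left (g := symJ d) (map_zero _)

lemma differentiable_fderiv {H : Phase d → ℝ} (hH : ContDiff ℝ (⊤ : ℕ∞) H) :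
    Differentiable ℝ (fderiv ℝ H) :=
  (hH.fderiv_right (m := (⊤ : ℕ∞)) (by simp)).differentiable (by simp)

lemma fderiv_hamVF {H : Phase d → ℝ} (hH : ContDiff ℝ (⊤ : ℕ∞) H) (x v : Phase d) :
    fderiv ℝ (hamVF H) x v = symJ d (fderiv ℝ (fderiv ℝ H) x v) := by
  have := ((symJ d).hasFDerivAt.comp x (differentiable_fderiv hH x).hasFDerivAt).fderiv
  change fderiv ℝ (hamVF H) x = _ at this
  rw [this]; rfl

lemma commute_of_poisson {H K : Phase d → ℝ} (hH : ContDiff ℝ (⊤ : ℕ∞) H)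
    (hK : ContDiff ℝ (⊤ : ℕ∞) K) {x : Phase d}
    (h : ∀ᶠ y in 𝓝 x, omega0 (hamVF H y) (hamVF K y) = 0) :
    fderiv ℝ (hamVF H) x (hamVF K x) = fderiv ℝ (hamVF K) x (hamVF H x) := by
  rw [fderiv_hamVF hH, fderiv_hamVF hK]
  congr 1
  refine ContinuousLinearMap.ext fun v => ?_
  have hd := (differentiable_fderiv hH x).hasFDerivAt.clm_apply
    ((symJ d).hasFDerivAt.comp x (differentiable_fderiv hK x).hasFDerivAt)
  have h0 : (fun y => fderiv ℝ H y ((symJ d ∘ fderiv ℝ K) y)) =ᶠ[𝓝 x] fun _ => 0 := by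
    filter_upwards [h] with y hy
    rw [hamVF_eq, omega0_symJ] at hy
    exact hy
  have h1 := hd.unique ((hasFDerivAt_const (0 : ℝ) x).congr_of_eventuallyEq h0)
  have h2 := congrArg (fun l => l v) h1
  simp only [ContinuousLinearMap.add_apply, ContinuousLinearMap.comp_apply,
    ContinuousLinearMap.flip_apply, ContinuousLinearMap.zero_apply, Function.comp_apply] at h2
  rw [symJ_skew] at h2
  have sH : IsSymmSndFDerivAt ℝ H x := hH.contDiffAt.isSymmSndFDerivAt (by
    rw [minSmoothness_of_isRCLikeNormedField]
    exact WithTop.coe_le_coe.2 le_top)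
  have sK : IsSymmSndFDerivAt ℝ K x := hK.contDiffAt.isSymmSndFDerivAt (by
    rw [minSmoothness_of_isRCLikeNormedField]
    exact WithTop.coe_le_coe.2 le_top)
  rw [sH.eq, sK.eq, hamVF_eq, hamVF_eq]
  linarith

lemma hamVF_avg {H K : Phase d → ℝ} {x : Phase d} (hH : DifferentiableAt ℝ H x)
    (hK : DifferentiableAt ℝ K x) :
    hamVF (fun x => (1 / 2) * (H x + K x)) x = (1 / 2 : ℝ) • (hamVF H x + hamVF K x) := by
  have : fderiv ℝ (fun x => (1 / 2) * (H x + K x)) x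
      = (1 / 2 : ℝ) • (fderiv ℝ H x + fderiv ℝ K x) :=
    ((hH.hasFDerivAt.add hK.hasFDerivAt).const_mul (1 / 2 : ℝ)).fderiv
  rw [hamVF_eq, this, map_smul, map_add]; rfl

lemma hamVF_congr {H K : Phase d → ℝ} {x : Phase d} (h : H =ᶠ[𝓝 x] K) : hamVF H x = hamVF K x := by
  rw [hamVF_eq, hamVF_eq, h.fderiv_eq]

lemma commute_avg {H K : Phase d → ℝ} (hH : ContDiff ℝ (⊤ : ℕ∞) H)
    (hK : ContDiff ℝ (⊤ : ℕ∞) K) {x : Phase d}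
    (h : ∀ᶠ y in 𝓝 x, omega0 (hamVF H y) (hamVF K y) = 0) :
    fderiv ℝ (hamVF fun x => (1 / 2) * (H x + K x)) x (hamVF H x) =
      fderiv ℝ (hamVF H) x (hamVF (fun x => (1 / 2) * (H x + K x)) x) := by
  have hfun : (hamVF fun x => (1 / 2) * (H x + K x)) =
      fun x => (1 / 2 : ℝ) • (hamVF H x + hamVF K x) :=
    funext fun x => hamVF_avg (hH.differentiable (by simp) x) (hK.differentiable (by simp) x)
  have hd := ((((contDiff_hamVF hH).differentiable (by simp) x).hasFDerivAt.add
    ((contDiff_hamVF hK).differentiable (by simp) x).hasFDerivAt).const_smul (1 / 2 : ℝ)).fderiv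
  change fderiv ℝ (fun x => (1 / 2 : ℝ) • (hamVF H x + hamVF K x)) x = _ at hd
  rw [hfun, hd]
  simp only [ContinuousLinearMap.smul_apply, ContinuousLinearMap.add_apply, map_smul, map_add]
  rw [commute_of_poisson hH hK h]

end ham_part

/-- Lemma 4.3 of the paper, for open subsets of the standard
symplectic `ℝ^{2d}`: if the Poisson bracket of `H` and `K` vanishes on `M`,
`Ĥ = (1/2)(H + K)`, and `γ` is a nonconstant `T`-periodic orbit of `X_Ĥ` in
`M` along which `X_H` and `X_K` are somewhere linearly independent, then `γ`
is not isolated: it admits a 1-parameter deformation by geometrically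
distinct `T`-periodic orbits of `X_Ĥ` with the same energy. -/
theorem stmt5 {d : ℕ} (hd : 1 ≤ d)
    {M : Set (Phase d)} (hM : IsOpen M)
    {H K : Phase d → ℝ} (hH : ContDiffOn ℝ (⊤ : ℕ∞) H M) (hK : ContDiffOn ℝ (⊤ : ℕ∞) K M)
    (hPoisson : ∀ x ∈ M, omega0 (hamVF H x) (hamVF K x) = 0)
    {γ : ℝ → Phase d} {T : ℝ} (hT : 0 < T) (hγM : ∀ t, γ t ∈ M)
    (hγ : IsPeriodicOrbit (fun x => (1 / 2) * (H x + K x)) γ T)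
    (hnc : ∃ t t', γ t ≠ γ t')
    {t₀ : ℝ} (hindep : LinearIndependent ℝ ![hamVF H (γ t₀), hamVF K (γ t₀)]) :
    ∃ ε > (0 : ℝ), ∃ Γ : ℝ → ℝ → Phase d,
      ContDiffOn ℝ (⊤ : ℕ∞) (fun p : ℝ × ℝ => Γ p.1 p.2) (Set.Ioo (-ε) ε ×ˢ Set.univ) ∧
      (∀ s ∈ Set.Ioo (-ε) ε, (∀ t, Γ s t ∈ M) ∧
        IsPeriodicOrbit (fun x => (1 / 2) * (H x + K x)) (Γ s) T ∧
        (∀ t, (1 / 2) * (H (Γ s t) + K (Γ s t)) = (1 / 2) * (H (γ t) + K (γ t)))) ∧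
      Γ 0 = γ ∧
      (∀ s ∈ Set.Ioo (-ε) ε, s ≠ 0 → Set.range (Γ s) ≠ Set.range γ) := by
  obtain ⟨hγd, hγp⟩ := hγ
  have hper : Function.Periodic γ T := hγp
  have hγc : Continuous γ := continuous_iff_continuousAt.2 fun t => (hγd t).continuousAt
  have hrange : γ '' Icc 0 (0 + T) = range γ := hper.image_Icc hT 0
  have hS : IsCompact (range γ) := by
    rw [← hrange]
    exact isCompact_Icc.image hγc
  have hSM : range γ ⊆ M := range_subset_iff.2 hγM
  have hHd : ∀ x ∈ M, DifferentiableAt ℝ H x := fun x hx =>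
    (hH.contDiffAt (hM.mem_nhds hx)).differentiableAt (by simp)
  have hKd : ∀ x ∈ M, DifferentiableAt ℝ K x := fun x hx =>
    (hK.contDiffAt (hM.mem_nhds hx)).differentiableAt (by simp)
  -- cut off the Hamiltonians
  obtain ⟨Kc, hKc, hSK, hKM⟩ := exists_compact_between hS hM hSM
  obtain ⟨χ, hχ1, hχ0, -⟩ := exists_contMDiffMap_one_nhds_of_subset_interior
    (n := (⊤ : ℕ∞)) (modelWithCornersSelf ℝ (Phase d)) hS.isClosed hSK
  have hχs : ContDiff ℝ (⊤ : ℕ∞) χ := χ.contMDiff.contDiff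
  rw [eventually_nhdsSet_iff_exists] at hχ1
  obtain ⟨N₀, hN₀, hSN₀, hN₀1⟩ := hχ1
  have hN : IsOpen (N₀ ∩ M) := hN₀.inter hM
  have hSN : range γ ⊆ N₀ ∩ M := subset_inter hSN₀ hSM
  obtain ⟨hH's, hH'c⟩ := cutoff hM hKc hKM hχs hχ0 hH
  obtain ⟨hK's, hK'c⟩ := cutoff hM hKc hKM hχs hχ0 hK
  set H' : Phase d → ℝ := fun x => χ x * H x with hH'
  set K' : Phase d → ℝ := fun x => χ x * K x with hK'
  have eH : ∀ x ∈ N₀ ∩ M, H' =ᶠ[𝓝 x] H := fun x hx => by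
    filter_upwards [hN.mem_nhds hx] with y hy
    simp [hH', hN₀1 y hy.1]
  have eK : ∀ x ∈ N₀ ∩ M, K' =ᶠ[𝓝 x] K := fun x hx => by
    filter_upwards [hN.mem_nhds hx] with y hy
    simp [hK', hN₀1 y hy.1]
  have eHK : ∀ x ∈ N₀ ∩ M, hamVF (fun x => (1 / 2) * (H' x + K' x)) x =
      hamVF (fun x => (1 / 2) * (H x + K x)) x := fun x hx => by
    apply hamVF_congr
    filter_upwards [eH x hx, eK x hx] with y h1 h2
    rw [h1, h2]
  have hZs : ContDiff ℝ (⊤ : ℕ∞) (fun x => (1 / 2) * (H' x + K' x)) :=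
    contDiff_const.mul (hH's.add hK's)
  have hZc : HasCompactSupport (fun x => (1 / 2) * (H' x + K' x)) :=
    (hH'c.add hK'c).comp_left (g := fun y : ℝ => (1 / 2) * y) (by simp)
  obtain ⟨ε, hε, Ψ, hΨ0, hΨs, hΨ⟩ := exists_family (contDiff_hamVF hH's) (contDiff_hamVF hZs)
    (hasCompactSupport_hamVF hH'c) (hasCompactSupport_hamVF hZc) hN
    (fun x hx => commute_avg hH's hK's (by
      filter_upwards [hN.mem_nhds hx] with y hy
      rw [hamVF_congr (eH y hy), hamVF_congr (eK y hy)]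
      exact hPoisson y hy.2))
    (γ := γ) (fun t => by
      rw [eHK _ (hSN (mem_range_self t))]
      exact hγd t) hS hSN
  -- distinctness
  have hdist : ∀ᶠ s in 𝓝 (0 : ℝ), ∀ t ∈ Icc (0 : ℝ) (0 + T), s ≠ 0 → Ψ s (γ t₀) ≠ γ t := by
    have h00 : (0 : ℝ) ∈ Ioo (-ε) ε := ⟨by linarith, hε⟩
    have hd1 := (hΨ 0 h00 t₀).2.1
    rw [hΨ0, hamVF_congr (eH _ (hSN (mem_range_self t₀)))] at hd1
    refine isCompact_Icc.eventually_forall_of_forall_eventually fun t _ => ?_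
    have hF : HasFDerivAt (fun z : ℝ × ℝ => Ψ z.1 (γ t₀) - γ z.2)
        ((ContinuousLinearMap.fst ℝ ℝ ℝ).smulRight (hamVF H (γ t₀)) -
          (ContinuousLinearMap.snd ℝ ℝ ℝ).smulRight
            (hamVF (fun x => (1 / 2) * (H x + K x)) (γ t))) (0, t) := by
      have a1 := HasFDerivAt.comp ((0, t) : ℝ × ℝ) (f := Prod.fst) hd1.hasFDerivAt
        (hasFDerivAt_fst (𝕜 := ℝ) (E := ℝ) (F := ℝ))
      have a2 := HasFDerivAt.comp ((0, t) : ℝ × ℝ) (f := Prod.snd) (hγd t).hasFDerivAt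
        (hasFDerivAt_snd (𝕜 := ℝ) (E := ℝ) (F := ℝ))
      refine (a1.sub a2).congr_fderiv ?_
      ext <;> simp
    by_cases hx : γ t₀ = γ t
    · have hinj : Function.Injective
        ((ContinuousLinearMap.fst ℝ ℝ ℝ).smulRight (hamVF H (γ t₀)) -
          (ContinuousLinearMap.snd ℝ ℝ ℝ).smulRight
            (hamVF (fun x => (1 / 2) * (H x + K x)) (γ t))) := by
        rw [injective_iff_map_eq_zero]
        rintro ⟨a, b⟩ hab
        rw [← hx, hamVF_avg (hHd _ (hγM t₀)) (hKd _ (hγM t₀))] at hab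
        rw [LinearIndependent.pair_iff] at hindep
        have := hindep (a - b / 2) (-(b / 2)) (by
          simp only [ContinuousLinearMap.sub_apply, ContinuousLinearMap.smulRight_apply,
            ContinuousLinearMap.coe_fst', ContinuousLinearMap.coe_snd'] at hab
          rw [← hab]
          module)
        ext <;> simp <;> linarith [this.1, this.2]
      have hanti := LinearMap.exists_antilipschitzWith _ (LinearMap.ker_eq_bot.2 hinj)
      obtain ⟨c, -, hc⟩ := hanti
      have hne := hF.eventually_ne (c := 0) ⟨c, hc⟩
      rw [eventually_nhdsWithin_iff] at hne
      filter_upwards [hne] with z hz hz0 heq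
      refine hz (fun h => hz0 ?_) (by rw [heq, sub_self])
      rw [mem_singleton_iff] at h
      rw [h]
    · have hne := hF.continuousAt.eventually_ne (y := 0) (by
        simp only [hΨ0]
        exact sub_ne_zero.2 hx)
      filter_upwards [hne] with z hz _ heq
      exact hz (by rw [heq, sub_self])
  obtain ⟨ε', hε', hdist⟩ := Metric.eventually_nhds_iff.1 hdist
  have hsub : ∀ s ∈ Ioo (-min ε ε') (min ε ε'), s ∈ Ioo (-ε) ε := fun s hs =>
    ⟨(neg_le_neg (min_le_left _ _)).trans_lt hs.1, hs.2.trans_le (min_le_left _ _)⟩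
  refine ⟨min ε ε', lt_min hε hε', fun s t => Ψ s (γ t), ?_, fun s hs => ⟨?_, ⟨?_, ?_⟩, ?_⟩, ?_, ?_⟩
  · exact hΨs.mono fun p hp => ⟨hsub _ hp.1, hp.2⟩
  · exact fun t => (hΨ s (hsub s hs) t).1.2
  · intro t
    rw [← eHK _ (hΨ s (hsub s hs) t).1]
    exact (hΨ s (hsub s hs) t).2.2
  · intro t
    simp only [hγp t]
  · intro t
    -- conservation of energy
    have hen : ∀ r ∈ Ioo (-ε) ε, HasDerivAt
        (fun r => (1 / 2) * (H (Ψ r (γ t)) + K (Ψ r (γ t)))) 0 r := by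
      intro r hr
      obtain ⟨hm, hd, -⟩ := hΨ r hr t
      rw [hamVF_congr (eH _ hm)] at hd
      have d1 := (hHd _ hm.2).hasFDerivAt.comp_hasDerivAt r hd
      have d2 := (hKd _ hm.2).hasFDerivAt.comp_hasDerivAt r hd
      refine ((d1.add d2).const_mul (1 / 2)).congr_deriv ?_
      have p := hPoisson _ hm.2
      rw [hamVF_eq, omega0_symJ, hamVF_eq] at p
      have q := symJ_skew (fderiv ℝ H (Ψ r (γ t))) (fderiv ℝ H (Ψ r (γ t)))
      have q' := symJ_skew (fderiv ℝ H (Ψ r (γ t))) (fderiv ℝ K (Ψ r (γ t)))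
      rw [hamVF_eq]
      linarith
    have := (convex_Ioo (-ε) ε).norm_image_sub_le_of_norm_hasDerivWithin_le (C := 0)
      (fun r hr => (hen r hr).hasDerivWithinAt) (fun r _ => by simp)
      (x := 0) (y := s) ⟨by linarith, hε⟩ (hsub s hs)
    rw [zero_mul, norm_le_zero_iff, hΨ0] at this
    exact sub_eq_zero.1 this
  · exact funext fun t => hΨ0 _
  · intro s hs hs0 heq
    have h1 : Ψ s (γ t₀) ∈ range γ := by
      rw [← heq]
      exact mem_range_self t₀
    rw [← hrange] at h1
    obtain ⟨t, ht, h2⟩ := h1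
    refine hdist (y := s) ?_ t ht hs0 h2.symm
    rw [Real.dist_eq, sub_zero]
    exact (abs_lt.2 hs).trans_le (min_le_right _ _)
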